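/- Let Σ be a symmetric positive definite p×p real matrix, let β ∈ ℝ^p and let σ > 0. Set v = σ² + βᵀΣβ, c = Σβ, and C = (σ⁻²ββᵀ + Σ⁻¹)⁻¹. Let D = diag(√Σ_11, …, √Σ_pp) and E = diag(√C_11, …, √C_pp), let ρΣ = D⁻¹ Σ D⁻¹ be the correlation matrix of Σ, let ρ ∈ ℝ^p be the vector with entries ρ_k = c_k / √(v · Σ_kk), and let R = diag(1/√(1 − ρ_1²), …, 1/√(1 − ρ_p²)). Then the correlation matrix of C satisfies E⁻¹ C E⁻¹ = R (ρΣ − ρ ρᵀ) R. -/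

import Mathlib

open Matrix

namespace Matrix

variable {n : Type*} [Fintype n] [DecidableEq n]

/-- Sherman–Morrison formula for the inverse of a rank-one update of `S⁻¹`. -/
theorem inv_smul_vecMulVec_add_inv {S : Matrix n n ℝ} (hS : S.IsSymm) (hdet : IsUnit S.det)
    (β : n → ℝ) {a : ℝ} (ha : a ≠ 0) (hv : a + β ⬝ᵥ S *ᵥ β ≠ 0) :
    (a⁻¹ • vecMulVec β β + S⁻¹)⁻¹ =
      S - (a + β ⬝ᵥ S *ᵥ β)⁻¹ • vecMulVec (S *ᵥ β) (S *ᵥ β) := by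
  apply inv_eq_right_inv
  have h_vec : β ᵥ* S = S *ᵥ β := by rw [← mulVec_transpose, hS.eq]
  rw [add_mul, mul_sub, mul_sub, nonsing_inv_mul _ hdet, smul_mul_assoc, smul_mul_assoc,
    mul_smul_comm, mul_smul_comm, vecMulVec_mul, h_vec, vecMulVec_mul_vecMulVec,
    mul_vecMulVec, mulVec_mulVec, nonsing_inv_mul _ hdet, one_mulVec]
  ext i j
  simp only [add_apply, sub_apply, smul_apply, vecMulVec_apply, smul_eq_mul, Pi.smul_apply]
  field_simp
  ring

theorem inv_diagonal_of_ne_zero {d : n → ℝ} (hd : ∀ i, d i ≠ 0) :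
    (diagonal d)⁻¹ = diagonal fun i => (d i)⁻¹ := by
  apply inv_eq_right_inv
  simp [diagonal_mul_diagonal, hd]

end Matrix

/-- Lemma 1 of the paper in matrix-algebra form: the correlation matrix of the full
conditional posterior covariance `C = (σ⁻² β βᵀ + S⁻¹)⁻¹` equals `R (ρS − ρρᵀ) R`,
where `ρS` is the correlation matrix of `S`, `ρ_k = (Sβ)_k / √(v · S k k)` with
`v = σ² + βᵀSβ`, and `R = diag(1/√(1 − ρ_k²))`. -/
theorem stmt4 {p : ℕ} (S : Matrix (Fin p) (Fin p) ℝ) (hS : S.PosDef)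
    (β : Fin p → ℝ) (σ : ℝ) (hσ : 0 < σ)
    (v : ℝ) (hv : v = σ ^ 2 + β ⬝ᵥ S *ᵥ β)
    (c : Fin p → ℝ) (hc : c = S *ᵥ β)
    (C : Matrix (Fin p) (Fin p) ℝ)
    (hC : C = ((σ ^ 2)⁻¹ • vecMulVec β β + S⁻¹)⁻¹)
    (D : Matrix (Fin p) (Fin p) ℝ) (hD : D = diagonal fun k => Real.sqrt (S k k))
    (E : Matrix (Fin p) (Fin p) ℝ) (hE : E = diagonal fun k => Real.sqrt (C k k))
    (ρS : Matrix (Fin p) (Fin p) ℝ) (hρS : ρS = D⁻¹ * S * D⁻¹)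
    (ρ : Fin p → ℝ) (hρ : ρ = fun k => c k / Real.sqrt (v * S k k))
    (R : Matrix (Fin p) (Fin p) ℝ)
    (hR : R = diagonal fun k => 1 / Real.sqrt (1 - ρ k ^ 2)) :
    E⁻¹ * C * E⁻¹ = R * (ρS - vecMulVec ρ ρ) * R := by
  have hSp : ∀ k, 0 < S k k := fun k => hS.diag_pos
  have hv0 : 0 < v := by
    have := hS.posSemidef.dotProduct_mulVec_nonneg β
    rw [star_trivial] at this
    rw [hv]
    positivity
  have hCp : ∀ k, 0 < C k k := by
    have h_rank : (vecMulVec β β).PosSemidef := by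
      simpa using posSemidef_vecMulVec_self_star β
    have h_pos : C.PosDef := hC ▸
      (PosDef.posSemidef_add (h_rank.smul (by positivity)) hS.inv).inv
    exact fun k => h_pos.diag_pos
  have h_entry : ∀ i j, C i j = S i j - v⁻¹ * (c i * c j) := by
    intro i j
    rw [hC, inv_smul_vecMulVec_add_inv (by simpa [IsSymm] using hS.isHermitian.eq)
      ((isUnit_iff_isUnit_det _).mp hS.isUnit) β (by positivity) (hv ▸ hv0.ne'), ← hv, ← hc]
    simp [vecMulVec_apply]
  have h_diag : ∀ k, C k k = S k k * (1 - ρ k ^ 2) := by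
    intro k
    have := (hSp k).ne'
    rw [h_entry, hρ, div_pow, Real.sq_sqrt (mul_pos hv0 (hSp k)).le]
    field_simp
  have h_sqrt : ∀ k, √(C k k) = √(S k k) * √(1 - ρ k ^ 2) := fun k => by
    rw [h_diag, Real.sqrt_mul (hSp k).le]
  have h_one_sub : ∀ k, 0 < √(1 - ρ k ^ 2) := fun k =>
    Real.sqrt_pos.mpr (pos_of_mul_pos_right (h_diag k ▸ hCp k) (hSp k).le)
  have h_sqrt_pos : ∀ k, 0 < √(S k k) := fun k => Real.sqrt_pos.mpr (hSp k)
  rw [hρS, hE, hD, hR, inv_diagonal_of_ne_zero fun k => (Real.sqrt_pos.mpr (hCp k)).ne',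
    inv_diagonal_of_ne_zero fun k => (h_sqrt_pos k).ne']
  ext i j
  have h_mul : ρ i * ρ j = v⁻¹ * (c i * c j) / (√(S i i) * √(S j j)) := by
    have := h_sqrt_pos i
    have := h_sqrt_pos j
    simp only [hρ, Real.sqrt_mul hv0.le]
    rw [div_mul_div_comm, mul_mul_mul_comm, Real.mul_self_sqrt hv0.le]
    field_simp
  simp only [mul_diagonal, diagonal_mul, Matrix.sub_apply, vecMulVec_apply]
  rw [h_mul, h_sqrt, h_sqrt, h_entry]
  have := h_sqrt_pos i
  have := h_sqrt_pos j
  have := h_one_sub i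
  have := h_one_sub j
  field_simp
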